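/- arXiv:1511.06446 — 4 statements merged into one kernel-verified Lean document; each statement's English description precedes it below -/
import Mathlib

section
/- For every integer d ≥ 1 and every subgroup G of the symmetric group Equiv.Perm (Fin d), there exists a polynomial F ∈ ℤ[x_1, …, x_d] (i.e. F : MvPolynomial (Fin d) ℤ) that belongs to G: for every permutation σ ∈ Equiv.Perm (Fin d), one has MvPolynomial.rename σ F = F if and only if σ ∈ G. -/
/-- For every subgroup `G` of `S_d` there is an integer multivariate polynomial
`F ∈ ℤ[x_1, …, x_d]` belonging to `G`: the stabilizer of `F` under the action of `S_d`
permuting the variables is exactly `G`. -/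
theorem exists_polynomial_belonging_to_subgroup (d : ℕ) (hd : 1 ≤ d)
    (G : Subgroup (Equiv.Perm (Fin d))) :
    ∃ F : MvPolynomial (Fin d) ℤ,
      ∀ σ : Equiv.Perm (Fin d), MvPolynomial.rename (⇑σ) F = F ↔ σ ∈ G := by
  classical
  let e : Fin d →₀ ℕ := Finsupp.equivFunOnFinite.symm (fun i => (i : ℕ))
  have he : ∀ i, e i = (i : ℕ) := fun i => rfl
  have hinj : ∀ σ τ : Equiv.Perm (Fin d),
      Finsupp.mapDomain σ e = Finsupp.mapDomain τ e → σ = τ := by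
    intro σ τ h
    ext i
    have h2 := DFunLike.congr_fun h (τ i)
    rw [Finsupp.mapDomain_apply τ.injective] at h2
    have h3 : Finsupp.mapDomain σ e (σ (σ⁻¹ (τ i))) = e (σ⁻¹ (τ i)) :=
      Finsupp.mapDomain_apply σ.injective _ _
    rw [show σ (σ⁻¹ (τ i)) = τ i from σ.apply_symm_apply _] at h3
    rw [h3, he, he] at h2
    have h4 : σ⁻¹ (τ i) = i := Fin.ext h2
    rw [Equiv.Perm.inv_eq_iff_eq] at h4
    rw [h4]
  have hcomp : ∀ σ τ : Equiv.Perm (Fin d), Finsupp.mapDomain σ (Finsupp.mapDomain τ e)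
      = Finsupp.mapDomain (σ * τ : Equiv.Perm (Fin d)) e := by
    intro σ τ
    rw [← Finsupp.mapDomain_comp]
    rfl
  let F : MvPolynomial (Fin d) ℤ :=
    ∑ τ : G, MvPolynomial.monomial (Finsupp.mapDomain (τ : Equiv.Perm (Fin d)) e) 1
  have hR : ∀ σ : Equiv.Perm (Fin d), MvPolynomial.rename σ F =
      ∑ τ : G, MvPolynomial.monomial
        (Finsupp.mapDomain (σ * (τ : Equiv.Perm (Fin d)) : Equiv.Perm (Fin d)) e) 1 := by
    intro σ
    simp only [F, map_sum, MvPolynomial.rename_monomial, hcomp]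
  refine ⟨F, fun σ => ⟨fun h => ?_, fun h => ?_⟩⟩
  · by_contra hσ
    have h0 : MvPolynomial.coeff (Finsupp.mapDomain σ e) F = 0 := by
      simp only [F, MvPolynomial.coeff_sum, MvPolynomial.coeff_monomial]
      refine Finset.sum_eq_zero fun τ _ => if_neg fun hh => hσ ?_
      rw [← hinj _ _ hh]
      exact τ.2
    rw [← h, hR] at h0
    simp only [MvPolynomial.coeff_sum, MvPolynomial.coeff_monomial] at h0
    rw [Finset.sum_eq_zero_iff_of_nonneg (fun τ _ => by split_ifs <;> simp)] at h0
    simpa using h0 1 (Finset.mem_univ _)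
  · rw [hR]
    exact Fintype.sum_equiv (Equiv.mulLeft (⟨σ, h⟩ : G)) _ _ (fun τ => rfl)
end

section
/- Let p ∈ ℤ[X] be monic with natDegree p = d ≥ 1, let q = p.map (Int.cast : ℤ → ℚ), let r : Fin d → q.rootSet ℂ be any assignment of complex roots of p, and let F ∈ MvPolynomial (Fin d) ℤ. Set v = the complex number obtained by evaluating F (with integer coefficients cast into ℂ) at the point (r(1), …, r(d)). If for every element g of the Galois group Gal(q) the evaluation of F at the point (g • r(1), …, g • r(d)) (via the Galois action galActionHom q ℂ on roots) also equals v, then v is a rational integer: there exists m ∈ ℤ with v = m. -/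
open Polynomial Polynomial.Gal

attribute [local instance] Polynomial.Gal.splits_ℚ_ℂ

theorem gal_fixed_aux {K : Type*} [Field K] [CharZero K] (q : Polynomial K)
    (w : q.SplittingField) (h : ∀ g : q.Gal, g w = w) :
    ∃ c, algebraMap K q.SplittingField c = w := by
  have : Normal K q.SplittingField := Normal.of_isSplittingField q
  have : IsGalois K q.SplittingField := IsGalois.mk
  exact (IsGalois.mem_range_algebraMap_iff_fixed (F := K) w).mpr h

/-- Let `p ∈ ℤ[X]` be monic of degree `d ≥ 1`, `q` its image in `ℚ[X]`, `r` an assignment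
of complex roots of `q`, and `F ∈ ℤ[x_1, …, x_d]`. If the value `v` of `F` at the roots
`r 1, …, r d` is fixed by the Galois action on roots, then `v` is a rational integer. -/
theorem galois_fixed_value_is_integer (p : Polynomial ℤ) (d : ℕ) (hd : 1 ≤ d)
    (hp : p.Monic) (hdeg : p.natDegree = d)
    (q : Polynomial ℚ) (hq : q = p.map (Int.castRingHom ℚ))
    (r : Fin d → q.rootSet ℂ) (F : MvPolynomial (Fin d) ℤ)
    (v : ℂ) (hv : v = MvPolynomial.aeval (fun i => (r i : ℂ)) F)
    (hfix : ∀ g : q.Gal,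
      MvPolynomial.aeval (fun i => ((galActionHom q ℂ g (r i) : q.rootSet ℂ) : ℂ)) F = v) :
    ∃ m : ℤ, v = (m : ℂ) := by
  let φ : q.SplittingField →ₐ[ℚ] ℂ := IsScalarTower.toAlgHom ℚ q.SplittingField ℂ
  let s : Fin d → q.SplittingField := fun i => ((rootsEquivRoots q ℂ).symm (r i)).1
  have hφs : ∀ (g : q.Gal) (i : Fin d),
      φ (g (s i)) = ((galActionHom q ℂ g (r i) : q.rootSet ℂ) : ℂ) := fun g i => rfl
  let w : q.SplittingField := MvPolynomial.eval₂ (Int.castRingHom _) s F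
  have hev : ∀ t : Fin d → ℂ, MvPolynomial.aeval t F
      = MvPolynomial.eval₂ (Int.castRingHom ℂ) t F := fun t => rfl
  have hw : ∀ g : q.Gal, φ (g w) = v := by
    intro g
    rw [← hfix g, hev]
    let ψ : q.SplittingField →+* ℂ :=
      φ.toRingHom.comp (AlgEquiv.toRingEquiv g).toRingHom
    have h := MvPolynomial.eval₂_comp_left ψ (Int.castRingHom q.SplittingField) s F
    rw [RingHom.eq_intCast' (ψ.comp (Int.castRingHom q.SplittingField))] at h
    exact h
  obtain ⟨c, hc⟩ := gal_fixed_aux q w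
    (fun g => φ.toRingHom.injective ((hw g).trans (hw 1).symm))
  have hvc : v = algebraMap ℚ ℂ c := by
    have h1 : v = φ w := (hw 1).symm
    rw [h1, ← hc, eq_ratCast, eq_ratCast, map_ratCast]
  have hint : IsIntegral ℤ v := by
    rw [hv]
    clear hw hv hfix hev
    refine MvPolynomial.induction_on
      (motive := fun F => IsIntegral ℤ (MvPolynomial.aeval (fun i => (r i : ℂ)) F)) F (fun a => ?_) (fun a b ha hb => ?_) (fun a i ha => ?_)
    · rw [MvPolynomial.aeval_C]; exact isIntegral_algebraMap
    · rw [map_add]; exact ha.add hb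
    · rw [map_mul, MvPolynomial.aeval_X]
      refine ha.mul ⟨p, hp, ?_⟩
      have h := (mem_rootSet.mp (r i).2).2
      have h2 : aeval ((r i : ℂ)) (p.map (Int.castRingHom ℚ)) = 0 := by
        rw [← hq]; exact h
      rw [aeval_def, eval₂_map] at h2
      rw [← h2]
      congr 1
  rw [hvc] at hint
  have hc' : IsIntegral ℤ c :=
    (isIntegral_algebraMap_iff (algebraMap ℚ ℂ).injective).mp hint
  obtain ⟨m, hm⟩ := IsIntegrallyClosed.isIntegral_iff.mp hc'
  exact ⟨m, by rw [hvc, ← hm]; simp⟩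
end

section
/- Let p ∈ ℤ[X] be monic with natDegree p = d ≥ 2 and with d distinct complex roots, enumerated by an injective map r : Fin d → (p.map (Int.cast : ℤ → ℚ)).rootSet ℂ. If every element of the Galois group of p acts on the roots by an even permutation — i.e. Equiv.Perm.sign (galActionHom g) = 1 for every g ∈ Gal(p) — then the square root of the discriminant δ = ∏_{i < j} (r(j) - r(i)) is a rational integer: there exists m ∈ ℤ with δ = m. (Equivalently, the resolvent polynomial Q_{A_d}(p)(x) = x² - δ² has an integer root.) -/
open Polynomial Polynomial.Gal

attribute [local instance] Polynomial.Gal.splits_ℚ_ℂ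

open scoped Classical

theorem fixed_aux' {F : Type*} [Field F] [CharZero F] (q : Polynomial F) (D : q.SplittingField)
    (h : ∀ g : q.Gal, g D = D) : ∃ x : F, algebraMap F q.SplittingField x = D := by
  have : Normal F q.SplittingField := Normal.of_isSplittingField q
  have : IsGalois F q.SplittingField := IsGalois.mk
  exact IntermediateField.mem_bot.1 ((IsGalois.mem_bot_iff_fixed D).2 h)

theorem fixed_aux (q : Polynomial ℚ) (D : q.SplittingField)
    (h : ∀ g : q.Gal, g D = D) : ∃ x : ℚ, (x : q.SplittingField) = D := by
  obtain ⟨x, hx⟩ := fixed_aux' q D h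
  exact ⟨x, by rw [← hx, eq_ratCast]⟩

/-- Let `p ∈ ℤ[X]` be monic of degree `d ≥ 2` with `d` distinct complex roots enumerated
by an injective `r`. If every element of the Galois group of `p` acts on the roots by an
even permutation, then the square root `δ = ∏_{i<j} (r j - r i)` of the discriminant is a
rational integer. -/
theorem sqrt_discriminant_is_integer (p : Polynomial ℤ) (d : ℕ) (hd : 2 ≤ d)
    (hp : p.Monic) (hdeg : p.natDegree = d)
    (r : Fin d → (p.map (Int.castRingHom ℚ)).rootSet ℂ) (hr : Function.Injective r)
    (heven : ∀ g : (p.map (Int.castRingHom ℚ)).Gal,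
      Equiv.Perm.sign (galActionHom (p.map (Int.castRingHom ℚ)) ℂ g) = 1)
    (δ : ℂ) (hδ : δ = ∏ j : Fin d, ∏ i ∈ Finset.Iio j, ((r j : ℂ) - (r i : ℂ))) :
    ∃ m : ℤ, δ = (m : ℂ) := by
  generalize hq : p.map (Int.castRingHom ℚ) = q at r hr heven hδ
  have hqm : q.Monic := hq ▸ hp.map _
  have hqd : q.natDegree = d := by rw [← hq, hp.natDegree_map, hdeg]
  have hcard : Fintype.card (q.rootSet ℂ) ≤ d := by
    rw [← Nat.card_eq_fintype_card]
    have := Polynomial.ncard_rootSet_le q ℂ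
    rw [hqd] at this
    exact this
  have hbij : Function.Bijective r := by
    rw [Fintype.bijective_iff_injective_and_card]
    refine ⟨hr, le_antisymm ?_ (by simpa using hcard)⟩
    exact Fintype.card_le_of_injective r hr
  let e : Fin d ≃ q.rootSet ℂ := Equiv.ofBijective r hbij
  let φ := rootsEquivRoots q ℂ
  let s : Fin d → q.SplittingField := fun i => (φ.symm (r i) : q.SplittingField)
  let D : q.SplittingField := ∏ j : Fin d, ∏ i ∈ Finset.Iio j, (s j - s i)
  have hs : ∀ i, algebraMap q.SplittingField ℂ (s i) = r i := by
    intro i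
    have : φ (φ.symm (r i)) = r i := Equiv.apply_symm_apply _ _
    exact congrArg Subtype.val this
  have hD : algebraMap q.SplittingField ℂ D = δ := by
    rw [hδ]
    simp only [D, map_prod, map_sub, hs]
  have hfix : ∀ g : q.Gal, g D = D := by
    intro g
    let σ : Equiv.Perm (Fin d) := e.symm.permCongr (galActionHom q ℂ g)
    have hσ : Equiv.Perm.sign σ = 1 := by
      rw [← heven g]
      exact Equiv.Perm.sign_permCongr _ _
    have hgs : ∀ i, g (s i) = s (σ i) := by
      intro i
      have h1 : r (σ i) = galActionHom q ℂ g (r i) := by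
        change e (e.symm _) = _
        rw [Equiv.apply_symm_apply]
        rfl
      have h2 : φ.symm (r (σ i)) = g • φ.symm (r i) := by
        rw [h1]
        exact Equiv.symm_apply_apply _ _
      exact (congrArg Subtype.val h2).symm
    have := Equiv.Perm.prod_Iio_comp_eq_sign_mul_prod (R := q.SplittingField) σ
      (f := fun i j => s j - s i) (by intros; ring)
    rw [hσ] at this
    simp only [Units.val_one, Int.cast_one, one_mul] at this
    have h3 : g D = ∏ j : Fin d, ∏ i ∈ Finset.Iio j, (s (σ j) - s (σ i)) := by
      simp only [D, map_prod, map_sub, hgs]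
    rw [h3]
    exact this
  obtain ⟨x, hx⟩ := fixed_aux q D hfix
  have hxδ : (x : ℂ) = δ := by
    rw [← hD, ← hx, map_ratCast]
  have hint : IsIntegral ℤ δ := by
    rw [hδ]
    have hri : ∀ i, IsIntegral ℤ (r i : ℂ) := by
      intro i
      have h := (Polynomial.mem_rootSet.1 (r i).2).2
      generalize (r i : ℂ) = z at h ⊢
      refine ⟨p, hp, ?_⟩
      rw [Polynomial.aeval_def, ← hq, Polynomial.eval₂_map] at h
      have hh : (algebraMap ℚ ℂ).comp (Int.castRingHom ℚ) = algebraMap ℤ ℂ := RingHom.ext_int _ _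
      rw [hh] at h
      exact h
    exact IsIntegral.prod _ fun j _ => IsIntegral.prod _ fun i _ => (hri j).sub (hri i)
  have hxi : IsIntegral ℤ x := by
    rw [← hxδ] at hint
    exact (isIntegral_algebraMap_iff (A := ℚ) (B := ℂ) (algebraMap ℚ ℂ).injective).1 hint
  obtain ⟨m, hm⟩ := IsIntegrallyClosed.isIntegral_iff.1 hxi
  refine ⟨m, ?_⟩
  rw [← hxδ, ← hm]
  simp
end

section
/- Fix a positive integer k. There exists a constant c > 0 such that, as x → ∞, the sum ∑_{1 ≤ n ≤ x} τ(n^k) is asymptotic to c · x · (log x)^k; in particular the average value of τ_k(n) = τ(n^k) over n ∈ [1, x] is asymptotic to a constant times (log x)^k. -/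
open Filter Asymptotics

namespace TauK
open ArithmeticFunction Finset

noncomputable def DD (j : ℕ) (x : ℝ) : ℝ :=
  ∑ n ∈ Finset.Ioc 0 ⌊x⌋₊, (((zeta : ArithmeticFunction ℕ) : ArithmeticFunction ℝ) ^ (j + 1)) n

lemma DD_zero (x : ℝ) : DD 0 x = (⌊x⌋₊ : ℝ) := by
  unfold DD
  rw [Finset.sum_congr rfl (g := fun _ => (1:ℝ))]
  · simp
  · intro n hn
    have : n ≠ 0 := by simp at hn; omega
    simp [natCoe_apply, zeta_apply, this]

lemma DD_succ (j : ℕ) (x : ℝ) :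
    DD (j + 1) x = ∑ m ∈ Finset.Ioc 0 ⌊x⌋₊, DD j (x / m) := by
  unfold DD
  rw [pow_succ' _ (j+1), sum_Ioc_mul_eq_sum_sum]
  refine Finset.sum_congr rfl fun m hm => ?_
  have : m ≠ 0 := by simp at hm; omega
  simp [natCoe_apply, zeta_apply, this, Nat.floor_div_natCast]

lemma pow_diff_upper (j : ℕ) {a b : ℝ} (hb : 0 ≤ b) (hab : b ≤ a) :
    a ^ (j + 1) - b ^ (j + 1) ≤ (j + 1) * a ^ j * (a - b) := by
  induction j with
  | zero => simp
  | succ j ih =>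
    have h1 : b ^ (j+1) ≤ a ^ (j+1) := by gcongr
    have e : a ^ (j+1+1) - b^(j+1+1) = a * (a^(j+1) - b^(j+1)) + b^(j+1) * (a - b) := by ring
    rw [e]
    have h2 := mul_le_mul_of_nonneg_left ih (hb.trans hab)
    have h3 := mul_le_mul_of_nonneg_right h1 (sub_nonneg.2 hab)
    push_cast
    have e2 : ((j:ℝ)+1+1) * a^(j+1) * (a-b) = a * ((j+1) * a^j*(a-b)) + a^(j+1)*(a-b) := by ring
    linarith

lemma pow_diff_lower (j : ℕ) {a b : ℝ} (hb : 0 ≤ b) (hab : b ≤ a) :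
    (j + 1) * b ^ j * (a - b) ≤ a ^ (j + 1) - b ^ (j + 1) := by
  induction j with
  | zero => simp
  | succ j ih =>
    have h1 : b ^ (j+1) ≤ a ^ (j+1) := by gcongr
    have e : a ^ (j+1+1) - b^(j+1+1) = b * (a^(j+1) - b^(j+1)) + a^(j+1) * (a - b) := by ring
    rw [e]
    have h2 := mul_le_mul_of_nonneg_left ih hb
    have h3 := mul_le_mul_of_nonneg_right h1 (sub_nonneg.2 hab)
    push_cast
    have e2 : ((j:ℝ)+1+1) * b^(j+1) * (a-b) = b * ((j+1) * b^j*(a-b)) + b^(j+1)*(a-b) := by ring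
    linarith

lemma log_step_le {m : ℕ} (hm : 0 < m) : Real.log (m + 1) - Real.log m ≤ 1 / m := by
  have h : (0:ℝ) < m := by exact_mod_cast hm
  rw [← Real.log_div (by positivity) (by positivity)]
  refine (Real.log_le_sub_one_of_pos (by positivity)).trans (le_of_eq ?_)
  field_simp; ring

lemma le_log_step {m : ℕ} (hm : 0 < m) : 1 / ((m:ℝ) + 1) ≤ Real.log (m + 1) - Real.log m := by
  have h : (0:ℝ) < m := by exact_mod_cast hm
  have h2 := Real.log_le_sub_one_of_pos (x := m / ((m:ℝ)+1)) (by positivity)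
  rw [Real.log_div (by positivity) (by positivity)] at h2
  have : (m:ℝ) / (m+1) - 1 = - (1/(m+1)) := by field_simp; ring
  linarith

/-- lower bound for the sum -/
lemma sum_lower (j : ℕ) (B : ℝ) (N : ℕ) (hN : 0 < N) (hB : Real.log N ≤ B)
    (hB' : B ≤ Real.log (N + 1)) :
    B ^ (j + 1) / (j + 1) ≤ ∑ m ∈ Finset.Ioc 0 N, (1 / (m:ℝ)) * (B - Real.log m) ^ j := by
  have key : ∀ M : ℕ, M + 1 ≤ N →
      B ^ (j+1) - (B - Real.log (M + 1)) ^ (j + 1) ≤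
        (j + 1) * ∑ m ∈ Finset.Ioc 0 M, (1 / (m:ℝ)) * (B - Real.log m) ^ j := by
    intro M
    induction M with
    | zero => intro _; simp
    | succ M ih =>
      intro h
      have ih := ih (by omega)
      rw [Finset.sum_Ioc_succ_top (by omega), mul_add]
      have hlog : Real.log ((M+1:ℕ) + 1) ≤ B := by
        refine le_trans (Real.log_le_log (by positivity) ?_) hB
        exact_mod_cast h
      have s := log_step_le (m := M+1) (by omega)
      have mono : Real.log (M+1:ℕ) ≤ Real.log ((M+1:ℕ) + 1) :=
        Real.log_le_log (by positivity) (by linarith)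
      have p := pow_diff_upper j (a := B - Real.log (M+1:ℕ)) (b := B - Real.log ((M+1:ℕ)+1))
        (by linarith) (by linarith)
      have q : ((j:ℝ)+1) * (B - Real.log (M+1:ℕ))^j * (B - Real.log (M+1:ℕ) - (B - Real.log ((M+1:ℕ)+1)))
         ≤ ((j:ℝ)+1) * (B - Real.log (M+1:ℕ))^j * (1 / (M+1:ℕ)) := by
        apply mul_le_mul_of_nonneg_left (by linarith)
        have : 0 ≤ B - Real.log (M+1:ℕ) := by linarith
        positivity
      have e : ((M+1:ℕ):ℝ) = M + 1 := by push_cast; ring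
      rw [e] at p q ⊢
      linarith
  obtain ⟨M, rfl⟩ : ∃ M, N = M + 1 := ⟨N - 1, by omega⟩
  have k1 := key M le_rfl
  rw [Finset.sum_Ioc_succ_top (by omega), div_le_iff₀ (by positivity)]
  have s := log_step_le (m := M+1) (by omega)
  have q : (B - Real.log (M+1:ℕ))^(j+1) ≤ (j+1) * ((1 / (M+1:ℕ)) * (B - Real.log (M+1:ℕ))^j) := by
    have h0 : 0 ≤ B - Real.log (M+1:ℕ) := by linarith
    have h1 : B - Real.log (M+1:ℕ) ≤ 1 / (M+1:ℕ) := by linarith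
    have hp : 0 ≤ (1 / ((M+1:ℕ):ℝ)) * (B - Real.log (M+1:ℕ))^j := by positivity
    calc (B - Real.log (M+1:ℕ))^(j+1) = (B - Real.log (M+1:ℕ)) * (B - Real.log (M+1:ℕ))^j := by ring
      _ ≤ (1 / (M+1:ℕ)) * (B - Real.log (M+1:ℕ))^j := by gcongr
      _ ≤ _ := by nlinarith [(Nat.cast_nonneg j : (0:ℝ) ≤ j)]
  have e : ((M+1:ℕ):ℝ) = M + 1 := by push_cast; ring
  rw [e] at q ⊢
  linarith

lemma sum_upper (j : ℕ) (B : ℝ) (N : ℕ) (hN : 0 < N) (hB : Real.log N ≤ B) :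
    ∑ m ∈ Finset.Ioc 0 N, (1 / (m:ℝ)) * (B - Real.log m) ^ j ≤ B ^ j + B ^ (j + 1) / (j + 1) := by
  have key : ∀ M : ℕ, M + 1 ≤ N →
        (j + 1) * ∑ m ∈ Finset.Ioc 0 (M + 1), (1 / (m:ℝ)) * (B - Real.log m) ^ j
        ≤ (j + 1) * B ^ j + (B ^ (j+1) - (B - Real.log (M + 1)) ^ (j + 1)) := by
    intro M
    induction M with
    | zero => intro _; simp
    | succ M ih =>
      intro h
      have ih := ih (by omega)
      rw [Finset.sum_Ioc_succ_top (by omega), mul_add]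
      have hlog : Real.log ((M+1:ℕ) + 1) ≤ B := by
        refine le_trans (Real.log_le_log (by positivity) ?_) hB
        exact_mod_cast h
      have s := le_log_step (m := M+1) (by omega)
      have mono : Real.log (M+1:ℕ) ≤ Real.log ((M+1:ℕ) + 1) :=
        Real.log_le_log (by positivity) (by linarith)
      have p := pow_diff_lower j (a := B - Real.log (M+1:ℕ)) (b := B - Real.log ((M+1:ℕ)+1))
        (by linarith) (by linarith)
      have q : ((j:ℝ)+1) * (B - Real.log ((M+1:ℕ)+1))^j * (1 / ((M+1:ℕ)+1)) ≤
         ((j:ℝ)+1) * (B - Real.log ((M+1:ℕ)+1))^j * (B - Real.log (M+1:ℕ) - (B - Real.log ((M+1:ℕ)+1)))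
          := by
        apply mul_le_mul_of_nonneg_left (by linarith)
        have : 0 ≤ B - Real.log ((M+1:ℕ)+1) := by linarith
        positivity
      have e : ((M+1:ℕ):ℝ) = M + 1 := by push_cast; ring
      have e' : ((M+1+1:ℕ):ℝ) = M + 1 + 1 := by push_cast; ring
      rw [e] at p q
      rw [e', e]
      linarith
  obtain ⟨M, rfl⟩ : ∃ M, N = M + 1 := ⟨N - 1, by omega⟩
  have k1 := key M le_rfl
  have h0 : 0 ≤ (B - Real.log (M + 1)) ^ (j + 1) := by
    have : 0 ≤ B - Real.log (M + 1) := by push_cast at hB; linarith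
    positivity
  have : B ^ j + B ^ (j + 1) / (j + 1) = ((j+1) * B ^ j + B ^ (j + 1)) / (j + 1) := by field_simp
  rw [this, le_div_iff₀ (by positivity)]
  linarith

lemma DD_upper (j : ℕ) : ∀ x : ℝ, 1 ≤ x → DD j x ≤ x * (j + Real.log x) ^ j / (j.factorial : ℝ) := by
  induction j with
  | zero => intro x hx; rw [DD_zero]; simpa using Nat.floor_le (by linarith)
  | succ j ih =>
    intro x hx
    have hN : 0 < ⌊x⌋₊ := Nat.floor_pos.2 hx
    have hNx : (⌊x⌋₊:ℝ) ≤ x := Nat.floor_le (by linarith)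
    have hL : 0 ≤ Real.log x := Real.log_nonneg hx
    rw [DD_succ]
    have h1 : ∑ m ∈ Finset.Ioc 0 ⌊x⌋₊, DD j (x / m) ≤
        ∑ m ∈ Finset.Ioc 0 ⌊x⌋₊, x / j.factorial * ((1 / (m:ℝ)) * ((j + Real.log x) - Real.log m) ^ j) := by
      refine Finset.sum_le_sum fun m hm => ?_
      simp only [Finset.mem_Ioc] at hm
      have hm0 : (0:ℝ) < m := by exact_mod_cast hm.1
      have hmx : (m:ℝ) ≤ x := le_trans (by exact_mod_cast hm.2) hNx
      refine (ih (x / m) ((one_le_div hm0).2 hmx)).trans (le_of_eq ?_)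
      rw [Real.log_div (by linarith) (by linarith)]
      field_simp
      ring
    refine h1.trans ?_
    rw [← Finset.mul_sum]
    have h2 := sum_upper j (j + Real.log x) ⌊x⌋₊ hN (by
      have := Real.log_le_log (by exact_mod_cast hN) hNx
      linarith [(Nat.cast_nonneg j : (0:ℝ) ≤ j)])
    refine (mul_le_mul_of_nonneg_left h2 (by positivity)).trans ?_
    have h3 := pow_diff_lower j (a := j + Real.log x + 1) (b := j + Real.log x) (by positivity) (by linarith)
    rw [Nat.factorial_succ]
    push_cast
    have e : x / j.factorial * ((j + Real.log x) ^ j + (j + Real.log x) ^ (j + 1) / (j + 1)) =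
      x * ((j+1) * (j + Real.log x) ^ j + (j + Real.log x) ^ (j + 1)) / ((j+1) * j.factorial) := by
      field_simp
    rw [e]
    gcongr
    have e3 : (j:ℝ) + 1 + Real.log x = j + Real.log x + 1 := by ring
    rw [e3]
    linarith

lemma DD_nonneg (j : ℕ) (x : ℝ) : 0 ≤ DD j x := by
  induction j generalizing x with
  | zero => rw [DD_zero]; positivity
  | succ j ih => rw [DD_succ]; exact Finset.sum_nonneg fun _ _ => ih _

lemma DD_lower (j : ℕ) (A ε : ℝ) (hA : 0 ≤ A) (hε : ε < 1) (hAe : 1 ≤ ε * Real.exp A) : ∀ x : ℝ, Real.exp A ≤ x →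
    (1 - ε) * x * (Real.log x - A) ^ j / (j.factorial : ℝ) ≤ DD j x := by
  have hε0 : 0 < ε := by
    by_contra h
    nlinarith [Real.exp_pos A]
  induction j with
  | zero =>
    intro x hx
    rw [DD_zero]
    have := Nat.lt_floor_add_one x
    simp
    nlinarith
  | succ j ih =>
    intro x hx
    have hx1 : 1 ≤ x := le_trans (Real.one_le_exp hA) hx
    set y := x / Real.exp A with hy
    have hxy : x = y * Real.exp A := by rw [hy]; field_simp
    have hy1 : 1 ≤ y := (one_le_div (Real.exp_pos A)).2 hx
    have hyx : y ≤ x := div_le_self (by linarith) (Real.one_le_exp hA)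
    have hN : 0 < ⌊y⌋₊ := Nat.floor_pos.2 hy1
    have hNy : (⌊y⌋₊:ℝ) ≤ y := Nat.floor_le (by linarith)
    have hly : Real.log y = Real.log x - A := by
      rw [hy, Real.log_div (by linarith) (Real.exp_pos A).ne', Real.log_exp]
    rw [DD_succ]
    have hsub : ∑ m ∈ Finset.Ioc 0 ⌊y⌋₊, DD j (x / m) ≤ ∑ m ∈ Finset.Ioc 0 ⌊x⌋₊, DD j (x / m) :=
      Finset.sum_le_sum_of_subset_of_nonneg
        (Finset.Ioc_subset_Ioc_right (Nat.floor_le_floor hyx)) (fun _ _ _ => DD_nonneg _ _)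
    refine le_trans ?_ hsub
    have h1 : ∑ m ∈ Finset.Ioc 0 ⌊y⌋₊, (1-ε) * x / j.factorial * ((1 / (m:ℝ)) * ((Real.log x - A) - Real.log m) ^ j)
        ≤ ∑ m ∈ Finset.Ioc 0 ⌊y⌋₊, DD j (x / m) := by
      refine Finset.sum_le_sum fun m hm => ?_
      simp only [Finset.mem_Ioc] at hm
      have hm0 : (0:ℝ) < m := by exact_mod_cast hm.1
      have hmy : (m:ℝ) ≤ y := le_trans (by exact_mod_cast hm.2) hNy
      refine le_trans (le_of_eq ?_) (ih (x / m) ?_)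
      · rw [Real.log_div (by linarith) (by linarith)]
        have : Real.log x - A - Real.log m = Real.log x - Real.log m - A := by ring
        rw [this]
        field_simp
      · rw [le_div_iff₀ hm0, hxy, mul_comm]
        gcongr
    refine le_trans ?_ h1
    rw [← Finset.mul_sum]
    have h2 := sum_lower j (Real.log x - A) ⌊y⌋₊ hN
      (by rw [← hly]; exact Real.log_le_log (by exact_mod_cast hN) hNy)
      (by rw [← hly]; exact Real.log_le_log (by linarith) (Nat.lt_floor_add_one y).le)
    refine le_trans (le_of_eq ?_) (mul_le_mul_of_nonneg_left h2 ?_)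
    · rw [Nat.factorial_succ]
      push_cast
      field_simp
    · have : 0 < 1 - ε := by linarith
      positivity

lemma DD_tendsto (j : ℕ) :
    Tendsto (fun x : ℝ => DD j x / (x * Real.log x ^ j)) atTop (nhds (1 / (j.factorial : ℝ))) := by
  have hlog := Real.tendsto_log_atTop
  have hup : Tendsto (fun x : ℝ => ((j / Real.log x + 1) ^ j) / (j.factorial : ℝ)) atTop
      (nhds (1 / (j.factorial : ℝ))) := by
    have := (((hlog.const_div_atTop (j:ℝ)).add_const 1).pow j).div_const (j.factorial : ℝ)
    simpa using this
  rw [tendsto_order]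
  constructor
  · intro a ha
    -- choose ε
    have hcont : Tendsto (fun ε : ℝ => (1 - ε) / (j.factorial:ℝ)) (nhdsWithin 0 (Set.Ioi 0))
        (nhds (1 / (j.factorial : ℝ))) := by
      have : ContinuousAt (fun ε : ℝ => (1 - ε) / (j.factorial:ℝ)) 0 := by fun_prop
      have := this.tendsto
      simp only [sub_zero] at this
      exact this.mono_left nhdsWithin_le_nhds
    have hlt : ∀ᶠ ε : ℝ in nhdsWithin 0 (Set.Ioi 0), ε < 1 :=
      nhdsWithin_le_nhds (gt_mem_nhds one_pos)
    obtain ⟨ε, ⟨hε1, hε2⟩, hε0⟩ := (((hcont.eventually (lt_mem_nhds ha)).and hlt).and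
      self_mem_nhdsWithin).exists
    have hε0 : 0 < ε := hε0
    set A := Real.log (1/ε) with hAdef
    have hA : 0 ≤ A := Real.log_nonneg ((one_le_div hε0).2 hε2.le)
    have hAe : 1 ≤ ε * Real.exp A := by
      rw [hAdef, Real.exp_log (by positivity)]; field_simp; rfl
    have hlow : Tendsto (fun x : ℝ => (1-ε) * ((1 - A / Real.log x) ^ j) / (j.factorial : ℝ)) atTop
        (nhds ((1-ε) / (j.factorial : ℝ))) := by
      have := ((((hlog.const_div_atTop A).const_sub 1).pow j).const_mul (1-ε)).div_const (j.factorial : ℝ)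
      simpa using this
    filter_upwards [hlow.eventually (lt_mem_nhds hε1), eventually_ge_atTop (Real.exp A),
      eventually_gt_atTop 1] with x h1 h2 h3
    refine h1.trans_le ?_
    have hL : 0 < Real.log x := Real.log_pos h3
    rw [le_div_iff₀ (by positivity)]
    refine le_trans (le_of_eq ?_) (DD_lower j A ε hA hε2 hAe x h2)
    have : Real.log x - A = (1 - A / Real.log x) * Real.log x := by field_simp
    rw [this, mul_pow]
    field_simp
  · intro a ha
    filter_upwards [hup.eventually (gt_mem_nhds ha), eventually_gt_atTop 1] with x h1 h3
    refine lt_of_le_of_lt ?_ h1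
    have hL : 0 < Real.log x := Real.log_pos h3
    rw [div_le_iff₀ (by positivity)]
    refine le_trans (DD_upper j x h3.le) (le_of_eq ?_)
    have : (j:ℝ) + Real.log x = (j / Real.log x + 1) * Real.log x := by field_simp
    rw [this, mul_pow]
    field_simp
end TauK

namespace TauK
open ArithmeticFunction Finset

noncomputable def PP (r : ℕ) : Polynomial ℝ :=
  (1 + Polynomial.C (r:ℝ) * Polynomial.X) * (1 - Polynomial.X) ^ r

lemma PP_coeff_zero (r : ℕ) : (PP r).coeff 0 = 1 := by
  simp [PP, Polynomial.coeff_zero_eq_eval_zero]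

lemma PP_coeff_one (r : ℕ) : (PP r).coeff 1 = 0 := by
  have h : (PP r).derivative.eval 0 = (PP r).coeff 1 := by
    rw [← Polynomial.coeff_zero_eq_eval_zero, Polynomial.coeff_derivative]; simp
  rw [← h]
  simp [PP, Polynomial.derivative_pow]

noncomputable def gg (r : ℕ) : ArithmeticFunction ℝ :=
  ⟨fun n => if n = 0 then 0 else n.factorization.prod (fun _ e => (PP r).coeff e), by simp⟩

lemma gg_apply (r n : ℕ) (hn : n ≠ 0) :
    gg r n = n.factorization.prod (fun _ e => (PP r).coeff e) := by
  change (if n = 0 then _ else _) = _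
  simp [hn]

lemma gg_mult (r : ℕ) : (gg r).IsMultiplicative := by
  rw [IsMultiplicative.iff_ne_zero]
  refine ⟨by simp [gg_apply], fun {m n} hm hn h => ?_⟩
  rw [gg_apply _ _ hm, gg_apply _ _ hn, gg_apply _ _ (mul_ne_zero hm hn),
    Nat.factorization_mul hm hn, Finsupp.prod_add_index_of_disjoint]
  exact h.disjoint_primeFactors

lemma gg_prime_pow (r : ℕ) {p : ℕ} (hp : p.Prime) (e : ℕ) : gg r (p ^ e) = (PP r).coeff e := by
  rw [gg_apply _ _ (pow_ne_zero _ hp.ne_zero), hp.factorization_pow, Finsupp.prod_single_index]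
  exact PP_coeff_zero r

noncomputable def loc (p : ℕ) (F : ArithmeticFunction ℝ) : PowerSeries ℝ :=
  PowerSeries.mk fun e => F (p ^ e)

lemma loc_mul {p : ℕ} (hp : p.Prime) (F G : ArithmeticFunction ℝ) :
    loc p (F * G) = loc p F * loc p G := by
  ext e
  simp only [loc, PowerSeries.coeff_mk, PowerSeries.coeff_mul]
  rw [mul_apply, Nat.sum_divisorsAntidiagonal (fun a b => F a * G b), Nat.sum_divisors_prime_pow hp,
    Finset.Nat.sum_antidiagonal_eq_sum_range_succ (fun a b => F (p^a) * G (p^b))]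
  refine Finset.sum_congr rfl fun i hi => ?_
  rw [Nat.pow_div (by simp at hi; omega) hp.pos]

lemma loc_one {p : ℕ} (hp : p.Prime) : loc p 1 = 1 := by
  ext e
  simp only [loc, PowerSeries.coeff_mk, PowerSeries.coeff_one, one_apply]
  have : p ^ e = 1 ↔ e = 0 := by simp [hp.ne_one]
  rw [if_congr this rfl rfl]

lemma loc_pow {p : ℕ} (hp : p.Prime) (F : ArithmeticFunction ℝ) (j : ℕ) :
    loc p (F ^ j) = loc p F ^ j := by
  induction j with
  | zero => simp [loc_one hp]
  | succ j ih => rw [pow_succ, loc_mul hp, ih, pow_succ]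

noncomputable def tt (k : ℕ) : ArithmeticFunction ℝ :=
  ⟨fun n => if n = 0 then 0 else ((n ^ k).divisors.card : ℝ), by simp⟩

lemma tt_apply (k n : ℕ) (hn : n ≠ 0) : tt k n = ((n ^ k).divisors.card : ℝ) := by
  change (if n = 0 then _ else _) = _
  simp [hn]

lemma tt_mult (k : ℕ) : (tt k).IsMultiplicative := by
  rw [IsMultiplicative.iff_ne_zero]
  refine ⟨by simp [tt_apply], fun {m n} hm hn h => ?_⟩
  rw [tt_apply _ _ hm, tt_apply _ _ hn, tt_apply _ _ (mul_ne_zero hm hn), mul_pow,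
    Nat.Coprime.card_divisors_mul (Nat.Coprime.pow k k h)]
  push_cast; rfl

lemma mk_one_sq : (PowerSeries.mk 1 : PowerSeries ℝ) ^ 2 = PowerSeries.mk fun e => (e:ℝ) + 1 := by
  ext e
  rw [sq, PowerSeries.coeff_mul]
  simp

lemma tt_eq (r : ℕ) : tt (r + 1) = gg r * ((zeta : ArithmeticFunction ℕ) : ArithmeticFunction ℝ) ^ (r + 1 + 1) := by
  have hz : ((zeta : ArithmeticFunction ℕ) : ArithmeticFunction ℝ).IsMultiplicative := isMultiplicative_zeta.natCast
  rw [(tt_mult _).eq_iff_eq_on_prime_powers _ _ ((gg_mult r).mul (hz.pow))]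
  intro p i hp
  have key : loc p (tt (r+1)) = loc p (gg r * ((zeta : ArithmeticFunction ℕ) : ArithmeticFunction ℝ) ^ (r + 1 + 1)) := by
    rw [loc_mul hp, loc_pow hp]
    have h1 : loc p ((zeta : ArithmeticFunction ℕ) : ArithmeticFunction ℝ) = PowerSeries.mk 1 := by
      ext e; simp [loc, natCoe_apply, zeta_apply, hp.ne_zero]
    have h2 : loc p (gg r) = (PP r : PowerSeries ℝ) := by
      ext e; simp [loc, gg_prime_pow r hp]
    have h3 : (PowerSeries.mk 1 : PowerSeries ℝ) * (1 - PowerSeries.X) = 1 :=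
      PowerSeries.mk_one_mul_one_sub_eq_one ℝ
    rw [h1, h2]
    have h4 : (PP r : PowerSeries ℝ) = (1 + PowerSeries.C (r:ℝ) * PowerSeries.X) * (1 - PowerSeries.X) ^ r := by
      have hcoe : ∀ q : Polynomial ℝ, (q : PowerSeries ℝ) = Polynomial.coeToPowerSeries.ringHom q := fun _ => rfl
      have hC : Polynomial.coeToPowerSeries.ringHom (Polynomial.C (r:ℝ)) = PowerSeries.C (r:ℝ) :=
        Polynomial.coe_C (r:ℝ)
      have hX : Polynomial.coeToPowerSeries.ringHom (Polynomial.X : Polynomial ℝ) = PowerSeries.X :=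
        Polynomial.coe_X
      rw [PP, hcoe, map_mul, map_add, map_mul, map_pow, map_sub, map_one, hC, hX]
    have h5 : (PP r : PowerSeries ℝ) * (PowerSeries.mk 1) ^ (r+1+1)
       = (1 + PowerSeries.C (r:ℝ) * PowerSeries.X) * (PowerSeries.mk 1)^2 := by
      rw [h4]
      calc _ = (1 + PowerSeries.C (r:ℝ) * PowerSeries.X) * (PowerSeries.mk 1)^2 * (PowerSeries.mk 1 * (1 - PowerSeries.X))^r := by rw [mul_pow]; ring
        _ = _ := by rw [h3]; ring
    rw [h5, mk_one_sq]
    ext e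
    rw [add_mul, one_mul, mul_assoc, map_add, PowerSeries.coeff_C_mul]
    simp only [loc, PowerSeries.coeff_mk]
    rw [tt_apply _ _ (pow_ne_zero _ hp.ne_zero), ← pow_mul, Nat.divisors_prime_pow hp]
    simp only [card_map, card_range]
    cases e with
    | zero => simp
    | succ e =>
      rw [PowerSeries.coeff_succ_X_mul, PowerSeries.coeff_mk]
      push_cast; ring
  have := congrArg (PowerSeries.coeff i) key
  simpa [loc] using this

/-- the weighted function -/
noncomputable def hh (r : ℕ) (n : ℕ) : ℝ := gg r n / n

lemma hh_zero (r : ℕ) : hh r 0 = 0 := by simp [hh]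
lemma hh_one (r : ℕ) : hh r 1 = 1 := by simp [hh, (gg_mult r).1]
lemma hh_mul (r : ℕ) {m n : ℕ} (h : m.Coprime n) : hh r (m * n) = hh r m * hh r n := by
  simp only [hh, (gg_mult r).2 h]
  push_cast
  rw [mul_div_mul_comm]

lemma hh_prime_pow (r : ℕ) {p : ℕ} (hp : p.Prime) (e : ℕ) :
    hh r (p ^ e) = (PP r).coeff e * (1 / (p:ℝ)) ^ e := by
  rw [hh, gg_prime_pow r hp]; push_cast; rw [one_div, inv_pow]; rfl

lemma hh_local_hasSum (r : ℕ) {p : ℕ} (hp : p.Prime) :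
    HasSum (fun e => hh r (p ^ e)) ((PP r).eval (1 / (p:ℝ))) := by
  rw [Polynomial.eval_eq_sum_range]
  simp only [hh_prime_pow r hp]
  apply hasSum_sum_of_ne_finset_zero
  intro e he
  rw [Polynomial.coeff_eq_zero_of_natDegree_lt, zero_mul]
  simp at he; omega

noncomputable def CC (r : ℕ) : ℝ := ∑ e ∈ range ((PP r).natDegree + 1), |(PP r).coeff e|

lemma CC_nonneg (r : ℕ) : 0 ≤ CC r := Finset.sum_nonneg fun _ _ => abs_nonneg _

lemma hh_abs_local_hasSum (r : ℕ) {p : ℕ} (hp : p.Prime) :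
    HasSum (fun e => |hh r (p ^ e)|)
      (∑ e ∈ range ((PP r).natDegree + 1), |(PP r).coeff e| * (1 / (p:ℝ)) ^ e) := by
  have : ∀ e, |hh r (p ^ e)| = |(PP r).coeff e| * (1 / (p:ℝ)) ^ e := by
    intro e
    rw [hh_prime_pow r hp, abs_mul, abs_of_nonneg (a := (1 / (p:ℝ)) ^ e) (by positivity)]
  simp only [this]
  apply hasSum_sum_of_ne_finset_zero
  intro e he
  rw [Polynomial.coeff_eq_zero_of_natDegree_lt, abs_zero, zero_mul]
  simp at he; omega

lemma local_bound (r : ℕ) {p : ℕ} (hp : p.Prime) :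
    ∑ e ∈ range ((PP r).natDegree + 1), |(PP r).coeff e| * (1 / (p:ℝ)) ^ e
      ≤ 1 + CC r * (1 / (p:ℝ) ^ 2) := by
  have hp1 : (1:ℝ) ≤ p := by exact_mod_cast hp.one_le
  rw [Finset.sum_range_succ', CC, Finset.sum_range_succ' _ (PP r).natDegree, PP_coeff_zero]
  have : ∑ e ∈ range (PP r).natDegree, |(PP r).coeff (e+1)| * (1 / (p:ℝ)) ^ (e+1) ≤
      (∑ e ∈ range (PP r).natDegree, |(PP r).coeff (e+1)|) * (1 / (p:ℝ)^2) := by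
    rw [Finset.sum_mul]
    refine Finset.sum_le_sum fun e _ => ?_
    rcases e with _ | e
    · simp [PP_coeff_one]
    · rw [← one_div_pow]
      refine mul_le_mul_of_nonneg_left ?_ (abs_nonneg _)
      exact pow_le_pow_of_le_one (by positivity) ((div_le_one (by linarith)).2 hp1) (by omega)
  have h2 : 0 ≤ 1 / (p:ℝ)^2 := by positivity
  simp only [abs_one, pow_zero, mul_one]
  nlinarith

lemma hh_summable_abs (r : ℕ) : Summable (fun n => |hh r n|) := by
  have hS : Summable (fun n : ℕ => 1 / (n:ℝ)^2) := Real.summable_one_div_nat_pow.2 (by norm_num)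
  refine summable_of_sum_le (c := Real.exp (CC r * ∑' n : ℕ, 1 / (n:ℝ)^2)) (fun _ => abs_nonneg _) ?_
  intro u
  obtain ⟨N, hN⟩ : ∃ N, ∀ n ∈ u, n < N := ⟨u.sup id + 1, fun n hn =>
    Nat.lt_succ_of_le (Finset.le_sup (f := id) hn)⟩
  have E := (EulerProduct.summable_and_hasSum_smoothNumbers_prod_primesBelow_tsum
    (f := fun n => |hh r n|) (by simp [hh_one]) (by intro m n h; simp [hh_mul r h, abs_mul])
    (by intro p hp; simpa using (hh_abs_local_hasSum r hp).summable) N).2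
  have h1 : ∑ n ∈ u, |hh r n| ≤ ∏ p ∈ N.primesBelow, ∑' n : ℕ, |hh r (p ^ n)| := by
    have hs : HasSum (Set.indicator (N.smoothNumbers) (fun n => |hh r n|)) _ :=
      (hasSum_subtype_iff_indicator (f := fun n => |hh r n|)).1 E
    refine le_trans (le_of_eq ?_) (sum_le_hasSum u (fun i _ => Set.indicator_nonneg (fun _ _ => abs_nonneg _) i) hs)
    refine Finset.sum_congr rfl fun n hn => ?_
    by_cases h0 : n = 0
    · subst h0
      have : (0:ℕ) ∉ N.smoothNumbers := fun h => (Nat.ne_zero_of_mem_smoothNumbers h) rfl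
      simp [this, hh_zero]
    · rw [Set.indicator_of_mem]
      exact Nat.mem_smoothNumbers_of_lt (Nat.pos_of_ne_zero h0) (hN n hn)
  refine h1.trans ?_
  calc _ ≤ ∏ p ∈ N.primesBelow, Real.exp (CC r * (1 / (p:ℝ)^2)) := by
        refine Finset.prod_le_prod (fun p _ => tsum_nonneg fun _ => abs_nonneg _) fun p hp => ?_
        have hp := Nat.prime_of_mem_primesBelow hp
        rw [(hh_abs_local_hasSum r hp).tsum_eq]
        refine (local_bound r hp).trans ?_
        linarith [Real.add_one_le_exp (CC r * (1 / (p:ℝ)^2))]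
    _ = Real.exp (CC r * ∑ p ∈ N.primesBelow, (1 / (p:ℝ)^2)) := by
        rw [← Real.exp_sum, Finset.mul_sum]
    _ ≤ _ := by
        gcongr
        · exact CC_nonneg r
        · exact hS.sum_le_tsum _ (fun _ _ => by positivity)

lemma PP_eval_pos (r : ℕ) {p : ℕ} (hp : p.Prime) : 0 < (PP r).eval (1 / (p:ℝ)) := by
  have h2 : (2:ℝ) ≤ p := by exact_mod_cast hp.two_le
  have h3 : 1 / (p:ℝ) < 1 := (div_lt_one (by linarith)).2 (by linarith)
  have : 0 < 1 - 1 / (p:ℝ) := by linarith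
  simp only [PP, Polynomial.eval_mul, Polynomial.eval_add, Polynomial.eval_one, Polynomial.eval_C,
    Polynomial.eval_X, Polynomial.eval_pow, Polynomial.eval_sub]
  positivity

lemma PP_eval_sub (r : ℕ) {p : ℕ} (hp : p.Prime) :
    |(PP r).eval (1 / (p:ℝ)) - 1| ≤ CC r * (1 / (p:ℝ)^2) := by
  have h := local_bound r hp
  rw [Finset.sum_range_succ', PP_coeff_zero] at h
  rw [Polynomial.eval_eq_sum_range, Finset.sum_range_succ', PP_coeff_zero]
  simp only [abs_one, pow_zero, mul_one, add_sub_cancel_right] at *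
  refine (Finset.abs_sum_le_sum_abs _ _).trans ?_
  have : ∀ e, |(PP r).coeff (e+1) * (1 / (p:ℝ))^(e+1)| = |(PP r).coeff (e+1)| * (1 / (p:ℝ))^(e+1) := by
    intro e
    rw [abs_mul, abs_of_nonneg (a := (1 / (p:ℝ)) ^ (e+1)) (by positivity)]
  simp only [this]
  linarith

lemma hh_tsum_pos (r : ℕ) : 0 < ∑' n, hh r n := by
  have E := EulerProduct.eulerProduct_hasProd (f := hh r) (hh_one r) (fun h => hh_mul r h)
    (by simpa using hh_summable_abs r) (hh_zero r)
  have hS : Summable (fun n : ℕ => 1 / (n:ℝ)^2) := Real.summable_one_div_nat_pow.2 (by norm_num)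
  have hS' : Summable (fun p : Nat.Primes => CC r * (1 / ((p:ℕ):ℝ)^2)) :=
    (hS.comp_injective (i := fun p : Nat.Primes => (p:ℕ)) Subtype.val_injective).mul_left _
  have e : ∀ p : Nat.Primes, ∑' e, hh r ((p:ℕ) ^ e) = (PP r).eval (1 / ((p:ℕ):ℝ)) :=
    fun p => (hh_local_hasSum r p.2).tsum_eq
  simp only [e] at E
  have hs2 : Summable (fun p : Nat.Primes => (PP r).eval (1 / ((p:ℕ):ℝ)) - 1) :=
    Summable.of_norm_bounded hS' fun p => by simpa using PP_eval_sub r p.2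
  have hs3 := Real.summable_log_one_add_of_summable hs2
  simp only [add_sub_cancel] at hs3
  rw [← E.tprod_eq, ← Real.rexp_tsum_eq_tprod (fun p => PP_eval_pos r p.2) hs3]
  exact Real.exp_pos _

end TauK

namespace TauK
open ArithmeticFunction Finset

lemma sum_eq (r : ℕ) (x : ℝ) :
    ∑ n ∈ Finset.Icc 1 ⌊x⌋₊, ((n ^ (r+1)).divisors.card : ℝ) =
      ∑' m : ℕ, gg r m * DD (r + 1) (x / m) := by
  have h0 : ∑ n ∈ Finset.Icc 1 ⌊x⌋₊, ((n ^ (r+1)).divisors.card : ℝ) =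
      ∑ n ∈ Finset.Ioc 0 ⌊x⌋₊, tt (r+1) n := by
    refine Finset.sum_congr (by ext; simp [Nat.succ_le_iff]) fun n hn => ?_
    rw [tt_apply]
    simp at hn; omega
  rw [h0, tt_eq, sum_Ioc_mul_eq_sum_sum]
  rw [tsum_eq_sum (s := Finset.Ioc 0 ⌊x⌋₊)]
  · refine Finset.sum_congr rfl fun m hm => ?_
    rw [DD, Nat.floor_div_natCast]
  · intro m hm
    by_cases h : m = 0
    · simp [h]
    · have : ⌊x⌋₊ < m := by simp at hm; omega
      rw [DD, Nat.floor_div_natCast, Nat.div_eq_of_lt this]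
      simp

lemma term_tendsto (j m : ℕ) (hm : m ≠ 0) :
    Tendsto (fun x : ℝ => DD j (x / m) / (x * Real.log x ^ j)) atTop
      (nhds (1 / (m:ℝ) * (1 / (j.factorial : ℝ)))) := by
  have hm0 : (0:ℝ) < m := by exact_mod_cast Nat.pos_of_ne_zero hm
  have h1 : Tendsto (fun x : ℝ => x / m) atTop atTop := tendsto_id.atTop_div_const hm0
  have h2 := (DD_tendsto j).comp h1
  have h3 : Tendsto (fun x : ℝ => (1 - Real.log m / Real.log x) ^ j) atTop (nhds 1) := by
    have := ((Real.tendsto_log_atTop.const_div_atTop (Real.log m)).const_sub 1).pow j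
    simpa using this
  have h4 := (h2.mul h3).const_mul (1 / (m:ℝ))
  rw [mul_one] at h4
  refine h4.congr' ?_
  filter_upwards [eventually_gt_atTop 1, h1.eventually_gt_atTop 1] with x hx hxm
  have hL : 0 < Real.log x := Real.log_pos hx
  have hLm : 0 < Real.log (x / m) := Real.log_pos hxm
  have e : 1 - Real.log m / Real.log x = Real.log (x / m) / Real.log x := by
    rw [Real.log_div (by linarith) (by linarith)]; field_simp
  simp only [Function.comp]
  rw [e, div_pow]
  field_simp

lemma term_bound (j m : ℕ) (hm : m ≠ 0) (x : ℝ) (hx : Real.exp 1 ≤ x) :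
    DD j (x / m) / (x * Real.log x ^ j) ≤ 1 / (m:ℝ) * (((j:ℝ) + 1) ^ j / (j.factorial : ℝ)) := by
  have hm0 : (0:ℝ) < m := by exact_mod_cast Nat.pos_of_ne_zero hm
  have hm1 : (1:ℝ) ≤ m := by exact_mod_cast Nat.pos_of_ne_zero hm
  have hx0 : 0 < x := (Real.exp_pos 1).trans_le hx
  have hL : 1 ≤ Real.log x := (Real.le_log_iff_exp_le hx0).2 hx
  by_cases h : 1 ≤ x / m
  · rw [div_le_iff₀ (by positivity)]
    refine (DD_upper j _ h).trans ?_
    have hl0 : 0 ≤ Real.log (x / m) := Real.log_nonneg h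
    have hl : Real.log (x / m) ≤ Real.log x :=
      Real.log_le_log (by positivity) (div_le_self hx0.le hm1)
    have : ((j:ℝ) + Real.log (x / m)) ≤ (j + 1) * Real.log x := by
      nlinarith [(Nat.cast_nonneg j : (0:ℝ) ≤ j)]
    calc x / m * (j + Real.log (x / m)) ^ j / (j.factorial : ℝ)
        ≤ x / m * ((j + 1) * Real.log x) ^ j / (j.factorial : ℝ) := by gcongr
      _ = _ := by rw [mul_pow]; field_simp
  · have : ⌊x / m⌋₊ = 0 := Nat.floor_eq_zero.2 (not_le.1 h)
    rw [DD, this]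
    simp
    positivity

end TauK

/-- For every fixed `k ≥ 1`, there is a constant `c > 0` such that
`∑_{1 ≤ n ≤ x} τ(n ^ k)` is asymptotic to `c * x * (log x) ^ k` as `x → ∞`;
in particular the average of `τ_k(n) = τ(n ^ k)` over `n ∈ [1, x]` is asymptotic to a
constant times `(log x) ^ k`. -/
theorem sum_tau_k_asymptotic (k : ℕ) (hk : 0 < k) :
    ∃ c : ℝ, 0 < c ∧
      (fun x : ℝ => ∑ n ∈ Finset.Icc 1 ⌊x⌋₊, ((n ^ k).divisors.card : ℝ)) ~[atTop]
        (fun x : ℝ => c * x * Real.log x ^ k) := by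
  obtain ⟨r, rfl⟩ : ∃ r, k = r + 1 := ⟨k - 1, by omega⟩
  have hpos := TauK.hh_tsum_pos r
  set F : ℝ := (((r + 1).factorial : ℕ) : ℝ) with hF
  have hF0 : 0 < F := by rw [hF]; exact_mod_cast Nat.factorial_pos _
  refine ⟨(∑' n, TauK.hh r n) * (1 / F), by positivity, ?_⟩
  have lim : Tendsto (fun x : ℝ => ∑' m : ℕ,
      TauK.gg r m * (TauK.DD (r + 1) (x / m) / (x * Real.log x ^ (r + 1)))) atTop
      (nhds (∑' m : ℕ, TauK.hh r m * (1 / F))) := by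
    refine tendsto_tsum_of_dominated_convergence
      (bound := fun m => |TauK.hh r m| * ((((r+1 : ℕ):ℝ) + 1) ^ (r+1) / F))
      ((TauK.hh_summable_abs r).mul_right _) ?_ ?_
    · intro m
      by_cases hm : m = 0
      · simp [hm, TauK.hh_zero]
      · have := (TauK.term_tendsto (r+1) m hm).const_mul (TauK.gg r m)
        rw [TauK.hh, div_eq_mul_one_div, mul_assoc]
        exact this
    · filter_upwards [eventually_ge_atTop (Real.exp 1)] with x hx m
      by_cases hm : m = 0
      · simp [hm, TauK.hh_zero]
      · have hb := TauK.term_bound (r+1) m hm x hx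
        have hx0 : 0 < x := (Real.exp_pos 1).trans_le hx
        have hL : 1 ≤ Real.log x := (Real.le_log_iff_exp_le hx0).2 hx
        have hn : 0 ≤ TauK.DD (r + 1) (x / m) / (x * Real.log x ^ (r + 1)) :=
          div_nonneg (TauK.DD_nonneg _ _) (by positivity)
        rw [Real.norm_eq_abs, abs_mul, abs_of_nonneg hn, TauK.hh, abs_div, Nat.abs_cast,
          div_eq_mul_one_div |TauK.gg r m|, mul_assoc]
        exact mul_le_mul_of_nonneg_left hb (abs_nonneg _)
  rw [tsum_mul_right] at lim
  have hc : (∑' n, TauK.hh r n) * (1 / F) ≠ 0 := by positivity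
  apply isEquivalent_of_tendsto_one
  have lim2 := lim.div_const ((∑' n, TauK.hh r n) * (1 / F))
  rw [div_self hc] at lim2
  refine lim2.congr' ?_
  filter_upwards [eventually_gt_atTop 1] with x hx
  have hL : 0 < Real.log x := Real.log_pos hx
  simp only [Pi.div_apply]
  rw [TauK.sum_eq]
  have : ∀ m : ℕ, TauK.gg r m * (TauK.DD (r + 1) (x / m) / (x * Real.log x ^ (r + 1))) =
      TauK.gg r m * TauK.DD (r + 1) (x / m) * (1 / (x * Real.log x ^ (r + 1))) := by
    intro m; ring
  simp only [this]
  rw [tsum_mul_right, mul_one_div, div_div]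
  congr 1
  ring
end
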